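/- arXiv:2207.03313 — 3 statements merged into one kernel-verified Lean document; each statement's English description precedes it below -/
import Mathlib

section
/- Let a < b and let γ : 𝕋 → (a,b) × 𝕋 be a continuous closed path (𝕋 = ℝ/2πℤ) that is not homotopic to a constant path in [a,b] × 𝕋. Then {a} × 𝕋 and {b} × 𝕋 lie in different connected components of ([a,b] × 𝕋) \ γ(𝕋). -/
/-- A loop whose pointwise distance to a nonvanishing loop `f` is smaller than `‖f‖` differs from
`f` by the exponential of a continuous function. -/
theorem exists_eq_mul_exp_of_norm_sub_lt {X : Type*} [TopologicalSpace X] {f g : X → ℂ}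
    (hf : Continuous f) (hg : Continuous g) (h : ∀ t, ‖g t - f t‖ < ‖f t‖) :
    ∃ k : X → ℂ, Continuous k ∧ ∀ t, g t = f t * Complex.exp (k t) := by
  have hf0 : ∀ t, f t ≠ 0 := fun t => norm_pos_iff.mp ((norm_nonneg _).trans_lt (h t))
  have hs : ∀ t, 1 + (g t - f t) / f t ∈ Complex.slitPlane := fun t =>
    Complex.mem_slitPlane_of_norm_lt_one (by
      rw [norm_div, div_lt_one (norm_pos_iff.mpr (hf0 t))]
      exact h t)
  refine ⟨fun t => Complex.log (1 + (g t - f t) / f t), ?_, fun t => ?_⟩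
  · exact (continuous_const.add ((hg.sub hf).div hf hf0)).clog hs
  · rw [Complex.exp_log (Complex.slitPlane_ne_zero (hs t))]
    field_simp [hf0 t]
    ring

/-- `f` has a continuous logarithm. -/
def HasContinuousLog {X : Type*} [TopologicalSpace X] (f : X → ℂ) : Prop :=
  ∃ k : X → ℂ, Continuous k ∧ ∀ t, f t = Complex.exp (k t)

theorem hasContinuousLog_congr_of_norm_sub_lt {X : Type*} [TopologicalSpace X] {f g : X → ℂ}
    (hf : Continuous f) (hg : Continuous g) (h : ∀ t, ‖g t - f t‖ < ‖f t‖) :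
    HasContinuousLog f ↔ HasContinuousLog g := by
  obtain ⟨k, hk, hgk⟩ := exists_eq_mul_exp_of_norm_sub_lt hf hg h
  constructor
  · rintro ⟨l, hl, hfl⟩
    exact ⟨fun t => l t + k t, hl.add hk, fun t => by rw [hgk, hfl, Complex.exp_add]⟩
  · rintro ⟨l, hl, hgl⟩
    refine ⟨fun t => l t - k t, hl.sub hk, fun t => ?_⟩
    rw [Complex.exp_sub, ← hgl, hgk, mul_div_cancel_right₀ _ (Complex.exp_ne_zero _)]

theorem hasContinuousLog_const {X : Type*} [TopologicalSpace X] {c : ℂ} (hc : c ≠ 0) :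
    HasContinuousLog (fun _ : X => c) :=
  ⟨fun _ => Complex.log c, continuous_const, fun _ => (Complex.exp_log hc).symm⟩

/-- Existence of a continuous logarithm of `Γ - z` does not depend on the choice of `z` in the
image of a preconnected set avoiding the loop `Γ`. -/
theorem IsPreconnected.hasContinuousLog_sub_iff {X Y : Type*} [TopologicalSpace X] [CompactSpace X]
    [TopologicalSpace Y] {s : Set Y} (hs : IsPreconnected s) {Γ : X → ℂ} (hΓ : Continuous Γ)
    {Φ : Y → ℂ} (hΦ : Continuous Φ) (hd : ∀ p ∈ s, Φ p ∉ Set.range Γ)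
    {p q : Y} (hp : p ∈ s) (hq : q ∈ s) :
    HasContinuousLog (fun t => Γ t - Φ p) ↔ HasContinuousLog (fun t => Γ t - Φ q) := by
  refine hs.induction₂
    (fun p q => HasContinuousLog (fun t => Γ t - Φ p) ↔ HasContinuousLog (fun t => Γ t - Φ q))
    (fun p hp => ?_) (fun _ _ _ _ _ _ => Iff.trans) (fun _ _ _ _ => Iff.symm) hp hq
  obtain ⟨ε, hε, hball⟩ := Metric.mem_nhds_iff.mp
    ((isCompact_range hΓ).isClosed.isOpen_compl.mem_nhds (hd p hp))
  filter_upwards [nhdsWithin_le_nhds (hΦ.continuousAt.preimage_mem_nhds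
    (Metric.ball_mem_nhds (Φ p) hε))] with q hq
  refine hasContinuousLog_congr_of_norm_sub_lt (hΓ.sub continuous_const)
    (hΓ.sub continuous_const) fun t => ?_
  have h₁ : ε ≤ ‖Γ t - Φ p‖ := by
    rw [← dist_eq_norm]
    exact not_lt.mp fun hlt => hball (Metric.mem_ball.mpr hlt) ⟨t, rfl⟩
  have h₂ : ‖Φ q - Φ p‖ < ε := by rw [← dist_eq_norm]; exact hq
  rw [show Γ t - Φ q - (Γ t - Φ p) = -(Φ q - Φ p) by ring, norm_neg]
  exact h₂.trans_le h₁

/-- The cylinder `ℝ × 𝕋` as the punctured plane, through `(r, θ) ↦ exp (r + i θ)`. -/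
noncomputable def cylinderExp (p : ℝ × AddCircle (2 * Real.pi)) : ℂ :=
  (Real.exp p.1 : ℂ) * (AddCircle.toCircle p.2 : ℂ)

theorem continuous_cylinderExp : Continuous cylinderExp := by
  have : Continuous (AddCircle.toCircle (T := 2 * Real.pi)) := AddCircle.continuous_toCircle
  unfold cylinderExp
  fun_prop

theorem norm_cylinderExp (p : ℝ × AddCircle (2 * Real.pi)) : ‖cylinderExp p‖ = Real.exp p.1 := by
  rw [cylinderExp, norm_mul, Circle.norm_coe, mul_one, Complex.norm_of_nonneg (Real.exp_pos _).le]

theorem cylinderExp_injective : Function.Injective cylinderExp := by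
  intro p q h
  have h₁ : p.1 = q.1 := Real.exp_injective (by rw [← norm_cylinderExp, h, norm_cylinderExp])
  refine Prod.ext h₁ (AddCircle.injective_toCircle Real.two_pi_pos.ne' (Circle.ext ?_))
  unfold cylinderExp at h
  rw [h₁] at h
  exact mul_left_cancel₀ (by exact_mod_cast (Real.exp_pos _).ne') h

theorem cylinderExp_coe (z : ℂ) :
    cylinderExp (z.re, (z.im : AddCircle (2 * Real.pi))) = Complex.exp z := by
  have : (2 * Real.pi / (2 * Real.pi)) = 1 := div_self Real.two_pi_pos.ne'
  rw [cylinderExp, AddCircle.toCircle_apply_mk, this, one_mul, Circle.coe_exp, Complex.ofReal_exp,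
    ← Complex.exp_add, Complex.re_add_im]

/-- A map into a cylinder over a contractible base whose angular coordinate lifts to `ℝ` is
nullhomotopic. -/
theorem nullhomotopic_of_lift {X B : Type*} [TopologicalSpace X] [TopologicalSpace B]
    [ContractibleSpace B] {T : ℝ} (γ : C(X, B × AddCircle T)) {l : X → ℝ} (hl : Continuous l)
    (h : ∀ t, (γ t).2 = (l t : AddCircle T)) : γ.Nullhomotopic := by
  let G : C(X, B × ℝ) := ⟨fun t => ((γ t).1, l t), by fun_prop⟩
  let F : C(B × ℝ, B × AddCircle T) :=
    ⟨fun p => (p.1, (p.2 : AddCircle T)),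
      continuous_fst.prodMk ((AddCircle.continuous_mk' T).comp continuous_snd)⟩
  have hFG : (F.comp (ContinuousMap.id _)).comp G = γ :=
    ContinuousMap.ext fun t => Prod.ext rfl (h t).symm
  rw [← hFG]
  exact ((id_nullhomotopic (B × ℝ)).comp_right F).comp_left G


/-- Let `a < b` and let `γ` be a continuous closed path in the open cylinder
`(a,b) × 𝕋` (viewed inside the closed cylinder `[a,b] × 𝕋`,
`𝕋 = ℝ/2πℤ`) which is not homotopic to a constant path in `[a,b] × 𝕋`.
Then `{a} × 𝕋` and `{b} × 𝕋` lie in different connected components of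
`([a,b] × 𝕋) \ γ(𝕋)`. -/
theorem stmt15 (a b : ℝ) (hab : a < b)
    (γ : C(AddCircle (2 * Real.pi), ↥(Set.Icc a b) × AddCircle (2 * Real.pi)))
    (hγ : ∀ t, ((γ t).1 : ℝ) ∈ Set.Ioo a b)
    (hhom : ∀ p : ↥(Set.Icc a b) × AddCircle (2 * Real.pi),
      ¬ ContinuousMap.Homotopic γ (ContinuousMap.const _ p)) :
    ∀ x y : ↥(Set.Icc a b) × AddCircle (2 * Real.pi),
      (x.1 : ℝ) = a → (y.1 : ℝ) = b →
      y ∉ connectedComponentIn (Set.range γ)ᶜ x := by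
  intro x y hx hy hmem
  have : Fact (0 < 2 * Real.pi) := ⟨Real.two_pi_pos⟩
  have : ContractibleSpace (Set.Icc a b) :=
    (convex_Icc a b).contractibleSpace (Set.nonempty_Icc.mpr hab.le)
  let Φ : ↥(Set.Icc a b) × AddCircle (2 * Real.pi) → ℂ := fun p => cylinderExp (p.1, p.2)
  have hΦ : Continuous Φ := continuous_cylinderExp.comp (by fun_prop)
  have hΦinj : Function.Injective Φ := fun p q h => by
    have h' := Prod.ext_iff.mp (cylinderExp_injective h)
    exact Prod.ext (Subtype.ext h'.1) h'.2
  have hΓ : Continuous fun t => Φ (γ t) := hΦ.comp γ.continuous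
  have hnorm : ∀ p, ‖Φ p‖ = Real.exp p.1 := fun p => norm_cylinderExp _
  have hxc : x ∈ (Set.range γ)ᶜ := by
    rintro ⟨t, rfl⟩
    exact (hγ t).1.ne' hx
  have hlog_y : HasContinuousLog fun t => Φ (γ t) - Φ y := by
    refine (hasContinuousLog_congr_of_norm_sub_lt continuous_const (hΓ.sub continuous_const)
      fun t => ?_).mp (hasContinuousLog_const (c := -Φ y) ?_)
    · change ‖Φ (γ t) - Φ y - -Φ y‖ < ‖-Φ y‖
      rw [sub_neg_eq_add, sub_add_cancel, norm_neg, hnorm, hnorm, hy]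
      exact Real.exp_lt_exp.mpr (hγ t).2
    · rw [neg_ne_zero, ← norm_pos_iff, hnorm]
      exact Real.exp_pos _
  have hlog_x : HasContinuousLog fun t => Φ (γ t) - Φ x := by
    refine (isPreconnected_connectedComponentIn.hasContinuousLog_sub_iff hΓ hΦ ?_
      (mem_connectedComponentIn hxc) hmem).mpr hlog_y
    rintro p hp ⟨t, ht⟩
    exact connectedComponentIn_subset _ _ hp ⟨t, hΦinj ht⟩
  obtain ⟨k, hk, hexp⟩ : HasContinuousLog fun t => Φ (γ t) := by
    refine (hasContinuousLog_congr_of_norm_sub_lt hΓ (hΓ.sub continuous_const)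
      fun t => ?_).mpr hlog_x
    change ‖Φ (γ t) - Φ x - Φ (γ t)‖ < ‖Φ (γ t)‖
    rw [sub_sub_cancel_left, norm_neg, hnorm, hnorm, hx]
    exact Real.exp_lt_exp.mpr (hγ t).1
  obtain ⟨p, hp⟩ := nullhomotopic_of_lift γ (Complex.continuous_im.comp hk) fun t =>
    (Prod.ext_iff.mp (cylinderExp_injective ((hexp t).trans (cylinderExp_coe (k t)).symm))).2
  exact hhom p hp
end

section
/- Let a < b and let ω be a connected open subset of [a,b] × 𝕋 such that {a} × 𝕋 and {b} × 𝕋 lie in different connected components of ([a,b] × 𝕋) \ ω. Let \tilde{ω} be a connected open subset of [a,b] × 𝕋 with \overline{ω} ⊂ \tilde{ω}. Then there exists a continuous closed path γ : 𝕋 → \tilde{ω} that is not homotopic to a constant path in [a,b] × 𝕋. -/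
open Set Filter Topology unitInterval

/-- A map to the circle that is homotopic to a constant map lifts to `ℝ`. -/
theorem AddCircle.exists_lift_of_homotopic_const {X : Type*} [TopologicalSpace X] {p : ℝ}
    {f : C(X, AddCircle p)} {c : AddCircle p} (h : f.Homotopic (ContinuousMap.const X c)) :
    ∃ g : C(X, ℝ), ∀ x, (g x : AddCircle p) = f x := by
  obtain ⟨H⟩ := h.symm
  obtain ⟨r, rfl⟩ := QuotientAddGroup.mk_surjective c
  have H0 : ∀ x, H (0, x) = ((ContinuousMap.const X r x : ℝ) : AddCircle p) :=
    fun x ↦ H.apply_zero x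
  let L := (AddCircle.isCoveringMap_coe p).liftHomotopy H.toContinuousMap
    (ContinuousMap.const X r) H0
  refine ⟨L.comp ((ContinuousMap.const X 1).prodMk (ContinuousMap.id X)), fun x ↦ ?_⟩
  exact (congr_fun ((AddCircle.isCoveringMap_coe p).liftHomotopy_lifts H.toContinuousMap
    (ContinuousMap.const X r) H0) (1, x)).trans (H.apply_one x)

/-- The quotient map `ℝ → AddCircle p` has no continuous section. -/
theorem AddCircle.not_exists_continuous_section {p : ℝ} (hp : p ≠ 0) :
    ¬ ∃ s : C(AddCircle p, ℝ), ∀ x, (s x : AddCircle p) = x := by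
  rintro ⟨s, hs⟩
  have key : (fun x : ℝ ↦ s (x : AddCircle p)) = fun x ↦ x + (s 0) := by
    refine (AddCircle.isCoveringMap_coe p).eq_of_comp_eq
      (s.continuous.comp (AddCircle.continuous_mk' p)) (by fun_prop) ?_ 0 (by simp)
    funext x
    change ((s x : ℝ) : AddCircle p) = ((x + s 0 : ℝ) : AddCircle p)
    rw [AddCircle.coe_add, hs, hs, add_zero]
  have h : s (p : AddCircle p) = p + s 0 := congr_fun key p
  rw [AddCircle.coe_period, right_eq_add] at h
  exact hp h

/-- The identity map of the circle is not homotopic to a constant map. -/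
theorem AddCircle.not_homotopic_id_const {p : ℝ} (hp : p ≠ 0) (c : AddCircle p) :
    ¬ (ContinuousMap.id (AddCircle p)).Homotopic (ContinuousMap.const _ c) :=
  fun h ↦ AddCircle.not_exists_continuous_section hp (AddCircle.exists_lift_of_homotopic_const h)

/-- A closed path, seen as a map on the circle of length `p`. -/
theorem Path.exists_addCircle_map {X : Type*} [TopologicalSpace X] {x : X} (γ : Path x x)
    {p : ℝ} (hp : 0 < p) :
    ∃ δ : C(AddCircle p, X), ∀ t : I, δ ((p * t : ℝ) : AddCircle p) = γ t := by
  have : Fact (0 < p) := ⟨hp⟩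
  have h0 : γ.extend (0 / p) = γ.extend (p / p) := by simp [hp.ne']
  refine ⟨⟨AddCircle.liftIco p 0 (fun s ↦ γ.extend (s / p)),
    AddCircle.liftIco_zero_continuous h0 (by fun_prop)⟩, fun t ↦ ?_⟩
  simp only [ContinuousMap.coe_mk]
  rcases t.2.2.lt_or_eq with h | h
  · rw [AddCircle.liftIco_zero_coe_apply ⟨mul_nonneg hp.le t.2.1, by nlinarith⟩,
      mul_div_cancel_left₀ _ hp.ne', γ.extend_apply t.2]
  · obtain rfl : t = 1 := Subtype.ext h
    have : ((p * ((1 : I) : ℝ) : ℝ) : AddCircle p) = ((0 : ℝ) : AddCircle p) := by simp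
    rw [this, AddCircle.liftIco_zero_coe_apply ⟨le_rfl, hp⟩]
    simp

/-- A map to the circle lifts to `ℝ` as soon as its restrictions to all closed paths do. -/
theorem AddCircle.exists_lift_of_forall_loop {A : Type*} [TopologicalSpace A]
    [PathConnectedSpace A] [LocallyPathConnectedSpace A] {p : ℝ} (hp : 0 < p)
    (f : C(A, AddCircle p))
    (h : ∀ δ : C(AddCircle p, A), ∃ g : C(AddCircle p, ℝ), ∀ x, (g x : AddCircle p) = f (δ x)) :
    ∃ F : C(A, ℝ), ∀ x, (F x : AddCircle p) = f x := by
  obtain ⟨a₀⟩ : Nonempty A := inferInstance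
  obtain ⟨e₀, he⟩ := QuotientAddGroup.mk_surjective (f a₀)
  have cov := AddCircle.isCoveringMap_coe p
  obtain ⟨F, ⟨-, hF⟩, -⟩ := cov.existsUnique_continuousMap_lifts_of_range_le (f := f) he (by
    rintro _ ⟨⟨γ⟩, rfl⟩
    obtain ⟨δ, hδ⟩ := Path.exists_addCircle_map γ hp
    obtain ⟨g, hg⟩ := h δ
    have hg0 : ((g 0 : ℝ) : AddCircle p) = (e₀ : AddCircle p) := by
      rw [hg]
      have := hδ 0
      simp only [Icc.coe_zero, mul_zero, AddCircle.coe_zero, Path.source] at this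
      rw [this]; exact he.symm
    let Γ : Path e₀ e₀ :=
      { toFun := fun t ↦ g ((p * t : ℝ) : AddCircle p) - g 0 + e₀
        continuous_toFun := by
          have := AddCircle.continuous_mk' p
          exact ((g.continuous.comp (this.comp (by fun_prop))).sub continuous_const).add
            continuous_const
        source' := by simp
        target' := by simp [AddCircle.coe_period] }
    refine ⟨FundamentalGroup.fromPath (Path.Homotopic.Quotient.mk Γ), ?_⟩
    rw [FundamentalGroup.mapOfEq_apply]
    change Path.Homotopic.Quotient.mk ((Γ.map cov.continuous).cast he.symm he.symm) =
      Path.Homotopic.Quotient.mk (γ.map f.continuous)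
    congr 1
    ext t
    change ((g ((p * t : ℝ) : AddCircle p) - g 0 + e₀ : ℝ) : AddCircle p) = f (γ t)
    rw [AddCircle.coe_add, AddCircle.coe_sub, hg0, hg, hδ, sub_add_cancel])
  exact ⟨F, fun x ↦ congr_fun hF x⟩

/-- In a compact Hausdorff space, closed sets that no connected component meets both of are
separated by a clopen set. -/
theorem exists_isClopen_of_disjoint_connectedComponent {X : Type*} [TopologicalSpace X]
    [CompactSpace X] [T2Space X] {A B : Set X} (hA : IsClosed A) (hB : IsClosed B)
    (h : ∀ x ∈ A, ∀ y ∈ B, y ∉ connectedComponent x) :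
    ∃ C : Set X, IsClopen C ∧ A ⊆ C ∧ Disjoint C B := by
  have hq : Continuous (ConnectedComponents.mk : X → ConnectedComponents X) :=
    ConnectedComponents.continuous_coe
  obtain ⟨C, hC, hAC, hCB⟩ := exists_clopen_of_closed_subset_open
    (Z := ConnectedComponents.mk '' A) (U := (ConnectedComponents.mk '' B)ᶜ)
    (hA.isCompact.image hq).isClosed (hB.isCompact.image hq).isClosed.isOpen_compl (by
      rintro _ ⟨x, hx, rfl⟩ ⟨y, hy, hxy⟩
      exact h x hx y hy (ConnectedComponents.coe_eq_coe'.1 hxy))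
  refine ⟨ConnectedComponents.mk ⁻¹' C, hC.preimage hq, fun x hx ↦ hAC ⟨x, hx, rfl⟩, ?_⟩
  rw [disjoint_left]
  exact fun x hx hxB ↦ hCB hx ⟨x, hxB, rfl⟩

/-- Splitting of a closed subset of a compact Hausdorff space into two closed parts, such that no
connected component of it that meets `A` meets `B`. -/
theorem IsClosed.exists_union_disjoint_of_connectedComponentIn {X : Type*} [TopologicalSpace X]
    [CompactSpace X] [T2Space X] {K A B : Set X} (hK : IsClosed K) (hA : IsClosed A)
    (hB : IsClosed B) (h : ∀ x ∈ A, ∀ y ∈ B, y ∉ connectedComponentIn K x) :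
    ∃ K₁ K₂ : Set X, IsClosed K₁ ∧ IsClosed K₂ ∧ K₁ ∪ K₂ = K ∧ Disjoint K₁ K₂ ∧
      Disjoint K₁ B ∧ Disjoint K₂ A := by
  have : CompactSpace K := isCompact_iff_compactSpace.1 hK.isCompact
  obtain ⟨C, hC, hAC, hCB⟩ := exists_isClopen_of_disjoint_connectedComponent (X := K)
    (hA.preimage continuous_subtype_val) (hB.preimage continuous_subtype_val) (by
      intro x hx y hy hxy
      refine h x hx y hy ?_
      rw [connectedComponentIn_eq_image x.2]
      exact ⟨y, hxy, rfl⟩)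
  refine ⟨(↑) '' C, (↑) '' Cᶜ, hK.isClosedEmbedding_subtypeVal.isClosedMap _ hC.isClosed,
    hK.isClosedEmbedding_subtypeVal.isClosedMap _ hC.compl.isClosed, ?_, ?_, ?_, ?_⟩
  · rw [← image_union, union_compl_self, image_univ, Subtype.range_coe]
  · exact (disjoint_image_iff Subtype.val_injective).2 disjoint_compl_right
  · rw [disjoint_left]
    rintro _ ⟨x, hx, rfl⟩ hxB
    exact disjoint_left.1 hCB hx hxB
  · rw [disjoint_left]
    rintro _ ⟨x, hx, rfl⟩ hxA
    exact hx (hAC hxA)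

/-- Let `f` be a map to the circle that has a lift `θ` to `ℝ` over an open neighbourhood `V` of the
closure of `U`. If the complement of `U` is the union of disjoint closed sets `K₁` and `K₂`,
and `A`, `B` are disjoint closed sets with `A` disjoint from `K₂` and `B` disjoint from `K₁`, then
there is a map to the circle that equals `f` on `A` and vanishes on `B`. -/
theorem AddCircle.exists_eqOn_of_lift {X : Type*} [TopologicalSpace X] [NormalSpace X] {p : ℝ}
    (f : C(X, AddCircle p)) {U V K₁ K₂ A B : Set X} (hV : IsOpen V)
    (hUV : closure U ⊆ V) (θ : C(V, ℝ)) (hθ : ∀ x : V, (θ x : AddCircle p) = f x)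
    (hK₁ : IsClosed K₁) (hK₂ : IsClosed K₂) (hK : K₁ ∪ K₂ = Uᶜ) (hd : Disjoint K₁ K₂)
    (hA : IsClosed A) (hB : IsClosed B) (hAB : Disjoint A B) (hK₁B : Disjoint K₁ B)
    (hK₂A : Disjoint K₂ A) :
    ∃ g : C(X, AddCircle p), EqOn g f A ∧ EqOn g 0 B := by
  classical
  obtain ⟨χ, hχ0, hχ1, -⟩ := exists_continuous_zero_one_of_isClosed (hK₂.union hB) (hK₁.union hA)
    (disjoint_union_left.2 ⟨disjoint_union_right.2 ⟨hd.symm, hK₂A⟩,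
      disjoint_union_right.2 ⟨hK₁B.symm, hAB.symm⟩⟩)
  let g : X → AddCircle p := fun x ↦
    if h : x ∈ V then ((χ x * θ ⟨x, h⟩ : ℝ) : AddCircle p) else if x ∈ K₁ then f x else 0
  have hgV : ∀ x (h : x ∈ V), g x = ((χ x * θ ⟨x, h⟩ : ℝ) : AddCircle p) := fun x h ↦ dif_pos h
  have hg1 : ∀ x ∈ K₁ ∪ A, g x = f x := by
    intro x hx
    by_cases h : x ∈ V
    · rw [hgV x h, hχ1 hx, Pi.one_apply, one_mul, hθ]
    · have hxK : x ∈ K₁ := by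
        have : x ∈ K₁ ∪ K₂ := hK ▸ fun hU ↦ h (hUV (subset_closure hU))
        exact hx.elim id fun hxA ↦ this.resolve_right fun h2 ↦ disjoint_left.1 hK₂A h2 hxA
      simp [g, h, hxK]
  have hg0 : ∀ x ∈ K₂ ∪ B, g x = 0 := by
    intro x hx
    by_cases h : x ∈ V
    · rw [hgV x h, hχ0 hx, Pi.zero_apply, zero_mul, AddCircle.coe_zero]
    · have hxK : x ∉ K₁ := fun h1 ↦
        hx.elim (fun h2 ↦ disjoint_left.1 hd h1 h2) fun hxB ↦ disjoint_left.1 hK₁B h1 hxB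
      simp [g, h, hxK]
  have hcl : ∀ x ∉ V, ∀ L : Set X, IsClosed L → x ∉ L → ∀ᶠ y in 𝓝 x, y ∉ L ∧ y ∉ U := by
    intro x hx L hL hxL
    filter_upwards [hL.isOpen_compl.mem_nhds hxL,
      isClosed_closure.isOpen_compl.mem_nhds fun h ↦ hx (hUV h)] with y h1 h2
    exact ⟨h1, fun h ↦ h2 (subset_closure h)⟩
  have hg : Continuous g := by
    rw [continuous_iff_continuousAt]
    intro x
    by_cases h : x ∈ V
    · have : ContinuousOn g V := by
        rw [continuousOn_iff_continuous_domRestrict]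
        have : V.domRestrict g = fun x : V ↦ ((χ x * θ x : ℝ) : AddCircle p) :=
          funext fun x ↦ hgV x x.2
        rw [this]
        exact (AddCircle.continuous_mk' p).comp (by fun_prop)
      exact this.continuousAt (hV.mem_nhds h)
    · have hx : x ∈ K₁ ∪ K₂ := hK ▸ fun hU ↦ h (hUV (subset_closure hU))
      rcases hx with hx | hx
      · refine f.continuous.continuousAt.congr ?_
        filter_upwards [hcl x h K₂ hK₂ (disjoint_left.1 hd hx)] with y hy
        have : y ∈ K₁ ∪ K₂ := hK ▸ hy.2
        exact (hg1 y (.inl (this.resolve_right hy.1))).symm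
      · refine (continuousAt_const (y := 0)).congr ?_
        filter_upwards [hcl x h K₁ hK₁ (disjoint_right.1 hd hx)] with y hy
        have : y ∈ K₁ ∪ K₂ := hK ▸ hy.2
        exact (hg0 y (.inl (this.resolve_left hy.1))).symm
  exact ⟨⟨g, hg⟩, fun x hx ↦ hg1 x (.inr hx), fun x hx ↦ hg0 x (.inr hx)⟩


/-- Let `a < b`, let `ω` be a connected open subset of the closed cylinder
`[a,b] × 𝕋` (`𝕋 = ℝ/2πℤ`) such that `{a} × 𝕋` and `{b} × 𝕋` lie in different
connected components of the complement of `ω`, and let `ω̃` be a connected open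
set with `closure ω ⊆ ω̃`. Then there exists a continuous closed path in `ω̃`
that is not homotopic to a constant path in `[a,b] × 𝕋`. -/
theorem stmt16 (a b : ℝ) (hab : a < b)
    (ω ωt : Set (↥(Set.Icc a b) × AddCircle (2 * Real.pi)))
    (hω : IsOpen ω) (hωconn : IsConnected ω)
    (hsep : ∀ x y : ↥(Set.Icc a b) × AddCircle (2 * Real.pi),
      (x.1 : ℝ) = a → (y.1 : ℝ) = b → y ∉ connectedComponentIn ωᶜ x)
    (hωt : IsOpen ωt) (hωtconn : IsConnected ωt) (hsub : closure ω ⊆ ωt) :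
    ∃ γ : C(AddCircle (2 * Real.pi), ↥(Set.Icc a b) × AddCircle (2 * Real.pi)),
      (∀ t, γ t ∈ ωt) ∧
      ∀ p : ↥(Set.Icc a b) × AddCircle (2 * Real.pi),
        ¬ ContinuousMap.Homotopic γ (ContinuousMap.const _ p) := by
  by_contra! hcon
  have hp : 0 < 2 * Real.pi := Real.two_pi_pos
  have := (convex_Icc a b).locallyPathConnectedSpace
  have : PathConnectedSpace (Icc a b) := isPathConnected_iff_pathConnectedSpace.1
    ((convex_Icc a b).isPathConnected (nonempty_Icc.2 hab.le))
  have : LocallyPathConnectedSpace (AddCircle (2 * Real.pi)) :=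
    isQuotientMap_quotient_mk'.locallyPathConnectedSpace
  have : LocallyPathConnectedSpace ωt := hωt.locallyPathConnectedSpace
  have : PathConnectedSpace ωt :=
    isPathConnected_iff_pathConnectedSpace.1 (hωt.isConnected_iff_isPathConnected.1 hωtconn)
  have : Fact (0 < 2 * Real.pi) := ⟨hp⟩
  let angle : C(↥(Icc a b) × AddCircle (2 * Real.pi), AddCircle (2 * Real.pi)) :=
    ContinuousMap.snd
  obtain ⟨θ, hθ⟩ := AddCircle.exists_lift_of_forall_loop hp
    (angle.comp (⟨(↑), continuous_subtype_val⟩ : C(ωt, _))) (by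
      intro δ
      obtain ⟨q, hq⟩ := hcon ((⟨(↑), continuous_subtype_val⟩ : C(ωt, _)).comp δ) fun t ↦ (δ t).2
      exact AddCircle.exists_lift_of_homotopic_const (c := angle q)
        (ContinuousMap.Homotopic.comp (.refl angle) hq))
  have hedge : ∀ c : ℝ, IsClosed {x : ↥(Icc a b) × AddCircle (2 * Real.pi) | (x.1 : ℝ) = c} :=
    fun c ↦ isClosed_eq (by fun_prop) continuous_const
  obtain ⟨K₁, K₂, hK₁, hK₂, hK, hd, hK₁B, hK₂A⟩ :=
    hω.isClosed_compl.exists_union_disjoint_of_connectedComponentIn (hedge a) (hedge b)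
      fun x hx y hy ↦ hsep x y hx hy
  obtain ⟨g, hgA, hgB⟩ := AddCircle.exists_eqOn_of_lift angle hωt hsub θ hθ hK₁ hK₂ hK hd
    (hedge a) (hedge b) (disjoint_left.2 fun x hx hx' ↦ hab.ne (hx.symm.trans hx')) hK₁B hK₂A
  let P : Path (⟨a, left_mem_Icc.2 hab.le⟩ : Icc a b) ⟨b, right_mem_Icc.2 hab.le⟩ :=
    PathConnectedSpace.somePath _ _
  refine AddCircle.not_homotopic_id_const hp.ne' 0 ⟨⟨⟨fun z ↦ g (P z.1, z.2), by fun_prop⟩,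
    fun x ↦ ?_, fun x ↦ ?_⟩⟩
  · exact (congr_arg (fun s ↦ g (s, x)) P.source).trans (hgA rfl)
  · exact (congr_arg (fun s ↦ g (s, x)) P.target).trans (hgB rfl)
end

section
/- Let a < b and let ω be an open subset of (a,b) × 𝕋. Suppose there is a continuous closed path γ = (γ_x, γ_y) : 𝕋 → ω such that {a} × 𝕋 and {b} × 𝕋 lie in different connected components of ([a,b] × 𝕋) \ γ(𝕋). Set ω₋ = [a, min γ_x] × 𝕋 and ω₊ = [max γ_x, b] × 𝕋. Then there exists χ ∈ C^∞([a,b] × 𝕋) with χ = 0 on ω₊ \ ω, χ = 1 on ω₋ \ ω, and supp(∇χ) ⊂ ω. -/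
open Metric MeasureTheory Set Convolution

/-- The covering map from the plane to the cylinder `ℝ × ℝ/Lℤ`. -/
def cylinderProj (L : ℝ) (p : ℝ × ℝ) : ℝ × AddCircle L := (p.1, (p.2 : AddCircle L))

theorem continuous_cylinderProj (L : ℝ) : Continuous (cylinderProj L) :=
  continuous_fst.prodMk ((AddCircle.continuous_mk' L).comp continuous_snd)

theorem dist_cylinderProj_le (L : ℝ) (p q : ℝ × ℝ) :
    dist (cylinderProj L p) (cylinderProj L q) ≤ dist p q := by
  rw [Prod.dist_eq, Prod.dist_eq]
  refine max_le_max le_rfl ?_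
  rw [dist_eq_norm, dist_eq_norm]
  exact QuotientAddGroup.norm_mk_le_norm (m := p.2 - q.2)

theorem surjective_cylinderProj (L : ℝ) : Function.Surjective (cylinderProj L) := by
  rintro ⟨x, y⟩
  obtain ⟨z, rfl⟩ := QuotientAddGroup.mk_surjective y
  exact ⟨(x, z), rfl⟩

/-- A preconnected subset of `U` meeting a component of `U` lies in that component. -/
theorem IsPreconnected.subset_connectedComponentIn_of_mem {X : Type*} [TopologicalSpace X]
    {S U : Set X} {x₀ x : X} (hS : IsPreconnected S) (hSU : S ⊆ U) (hx : x ∈ S)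
    (hx₀ : x ∈ _root_.connectedComponentIn U x₀) :
    S ⊆ _root_.connectedComponentIn U x₀ := by
  rw [connectedComponentIn_eq hx₀]
  exact hS.subset_connectedComponentIn hx hSU

/-- The lift to the plane of the indicator of a component of an open subset of the cylinder is
constant on balls whose image lies in that open subset. -/
theorem indicator_connectedComponentIn_eq {L r : ℝ} {U : Set (ℝ × AddCircle L)}
    (x₀ : ℝ × AddCircle L) {p q : ℝ × ℝ} (hU : ∀ q ∈ ball p r, cylinderProj L q ∈ U)
    (hq : q ∈ ball p r) :
    (connectedComponentIn U x₀).indicator (fun _ => (1 : ℝ)) (cylinderProj L q) =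
      (connectedComponentIn U x₀).indicator (fun _ => (1 : ℝ)) (cylinderProj L p) := by
  have hpre : IsPreconnected (cylinderProj L '' ball p r) :=
    (convex_ball p r).isPreconnected.image _ (continuous_cylinderProj L).continuousOn
  have hsub : cylinderProj L '' ball p r ⊆ U := by
    rintro _ ⟨z, hz, rfl⟩
    exact hU z hz
  have hp : p ∈ ball p r := mem_ball_self (pos_of_mem_ball hq)
  have hiff : cylinderProj L q ∈ connectedComponentIn U x₀ ↔
      cylinderProj L p ∈ connectedComponentIn U x₀ :=
    ⟨fun h => hpre.subset_connectedComponentIn_of_mem hsub (mem_image_of_mem _ hq) h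
        (mem_image_of_mem _ hp),
      fun h => hpre.subset_connectedComponentIn_of_mem hsub (mem_image_of_mem _ hp) h
        (mem_image_of_mem _ hq)⟩
  by_cases h : cylinderProj L p ∈ connectedComponentIn U x₀
  · rw [indicator_of_mem h, indicator_of_mem (hiff.2 h)]
  · rw [indicator_of_notMem h, indicator_of_notMem (mt hiff.1 h)]

theorem isOpen_preimage_connectedComponentIn {L : ℝ} {U : Set (ℝ × AddCircle L)} (hU : IsOpen U)
    (x₀ : ℝ × AddCircle L) : IsOpen (cylinderProj L ⁻¹' connectedComponentIn U x₀) := by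
  rw [Metric.isOpen_iff]
  intro p hp
  obtain ⟨r, hr, hrU⟩ := Metric.isOpen_iff.1 (hU.preimage (continuous_cylinderProj L)) p
    (connectedComponentIn_subset U x₀ hp)
  refine ⟨r, hr, fun q hq => ?_⟩
  have hpre : IsPreconnected (cylinderProj L '' ball p r) :=
    (convex_ball p r).isPreconnected.image _ (continuous_cylinderProj L).continuousOn
  exact hpre.subset_connectedComponentIn_of_mem (image_subset_iff.2 hrU)
    (mem_image_of_mem _ (mem_ball_self hr)) hp (mem_image_of_mem _ hq)

/-- Mollification of the indicator of a component of an open subset of the cylinder: the result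
agrees with the indicator, and has vanishing gradient, away from the complement. -/
theorem exists_contDiff_eq_indicator_connectedComponentIn {L δ : ℝ} (hδ : 0 < δ)
    {U : Set (ℝ × AddCircle L)} (hU : IsOpen U) (x₀ : ℝ × AddCircle L) :
    ∃ χ : ℝ × AddCircle L → ℝ,
      ContDiff ℝ (⊤ : ℕ∞) (fun p : ℝ × ℝ => χ (cylinderProj L p)) ∧
      ∀ p : ℝ × ℝ, (∀ q, dist q (cylinderProj L p) < δ → q ∈ U) →
        χ (cylinderProj L p) =
            (connectedComponentIn U x₀).indicator (fun _ => 1) (cylinderProj L p) ∧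
          p ∉ tsupport (fderiv ℝ (fun p : ℝ × ℝ => χ (cylinderProj L p))) := by
  let f : ℝ × AddCircle L → ℝ := (connectedComponentIn U x₀).indicator (fun _ => 1)
  let g : ℝ × ℝ → ℝ := fun p => f (cylinderProj L p)
  let φ : ContDiffBump (0 : ℝ × ℝ) := ⟨δ / 4, δ / 2, by positivity, by linarith⟩
  have hg : LocallyIntegrable g volume := by
    have : g = (cylinderProj L ⁻¹' connectedComponentIn U x₀).indicator (fun _ => (1 : ℝ)) := rfl
    rw [this]
    exact (locallyIntegrable_const 1).indicator
      (isOpen_preimage_connectedComponentIn hU x₀).measurableSet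
  let F : ℝ × ℝ → ℝ := φ.normed volume ⋆[ContinuousLinearMap.lsmul ℝ ℝ, volume] g
  let χ : ℝ × AddCircle L → ℝ := fun p =>
    ∫ t, ContinuousLinearMap.lsmul ℝ ℝ (φ.normed volume t) (f (p - cylinderProj L t))
  have hχ : (fun p : ℝ × ℝ => χ (cylinderProj L p)) = F := rfl
  have hloc : ∀ p : ℝ × ℝ, (∀ q, dist q (cylinderProj L p) < δ → q ∈ U) →
      ∀ q ∈ ball p (δ / 2), F q = f (cylinderProj L p) := by
    intro p hp q hq
    have hpU : ∀ z ∈ ball p δ, cylinderProj L z ∈ U := fun z hz =>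
      hp _ ((dist_cylinderProj_le L z p).trans_lt hz)
    have hconst : ∀ z ∈ ball p δ, g z = g p := fun z hz =>
      indicator_connectedComponentIn_eq x₀ hpU hz
    have hqp : g q = g p := hconst q (ball_subset_ball (by linarith) hq)
    have := φ.normed_convolution_eq_right (μ := volume) (g := g) (x₀ := q) fun z hz => by
      rw [hqp]
      refine hconst z ?_
      have h1 : dist z q < δ / 2 := hz
      have h2 : dist q p < δ / 2 := hq
      exact (dist_triangle z q p).trans_lt (by linarith)
    exact this.trans hqp
  refine ⟨χ, ?_, fun p hp => ⟨?_, ?_⟩⟩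
  · rw [hχ]
    exact φ.hasCompactSupport_normed.contDiff_convolution_left _ φ.contDiff_normed hg
  · exact hloc p hp p (mem_ball_self (by positivity))
  · rw [hχ, notMem_tsupport_iff_eventuallyEq]
    have hev : F =ᶠ[nhds p] fun _ => f (cylinderProj L p) := by
      filter_upwards [ball_mem_nhds p (half_pos hδ)] with q hq using hloc p hp q hq
    refine hev.fderiv.trans ?_
    filter_upwards with q
    simp


/-- Existence of the cutoff function: let `a < b`, let `ω` be an open subset of
the open cylinder `(a,b) × 𝕋 ⊂ ℝ × 𝕋` (`𝕋 = ℝ/2πℤ`), and let `γ` be a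
continuous closed path in `ω` such that `{a} × 𝕋` and `{b} × 𝕋` lie in
different connected components of `([a,b] × 𝕋) \ γ(𝕋)`. With
`ω₋ = [a, min γ_x] × 𝕋` and `ω₊ = [max γ_x, b] × 𝕋`, there is a smooth
function `χ` on `ℝ × 𝕋` (smoothness expressed through the periodic lift to
`ℝ × ℝ`) with `χ = 0` on `ω₊ \ ω`, `χ = 1` on `ω₋ \ ω`, and
`supp ∇χ ⊆ ω`. -/
theorem stmt17 (a b : ℝ) (hab : a < b)
    (ω : Set (ℝ × AddCircle (2 * Real.pi))) (hω : IsOpen ω)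
    (hωsub : ω ⊆ Set.Ioo a b ×ˢ Set.univ)
    (γ : C(AddCircle (2 * Real.pi), ℝ × AddCircle (2 * Real.pi)))
    (hγω : ∀ t, γ t ∈ ω)
    (hsep : ∀ x y : ℝ × AddCircle (2 * Real.pi), x.1 = a → y.1 = b →
      y ∉ connectedComponentIn ((Set.Icc a b ×ˢ Set.univ) \ Set.range γ) x) :
    ∃ χ : ℝ × AddCircle (2 * Real.pi) → ℝ,
      ContDiff ℝ (⊤ : ℕ∞) (fun p : ℝ × ℝ => χ (p.1, (p.2 : AddCircle (2 * Real.pi)))) ∧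
      (∀ p ∈ (Set.Icc (sSup (Set.range fun t => (γ t).1)) b ×ˢ
          (Set.univ : Set (AddCircle (2 * Real.pi)))) \ ω, χ p = 0) ∧
      (∀ p ∈ (Set.Icc a (sInf (Set.range fun t => (γ t).1)) ×ˢ
          (Set.univ : Set (AddCircle (2 * Real.pi)))) \ ω, χ p = 1) ∧
      tsupport (fderiv ℝ (fun p : ℝ × ℝ => χ (p.1, (p.2 : AddCircle (2 * Real.pi)))))
        ⊆ {p : ℝ × ℝ | (p.1, (p.2 : AddCircle (2 * Real.pi))) ∈ ω} := by
  have : Fact (0 < 2 * Real.pi) := ⟨Real.two_pi_pos⟩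
  let L := 2 * Real.pi
  have hK : IsCompact (range γ) := isCompact_range γ.continuous
  have hKω : range γ ⊆ ω := by
    rintro _ ⟨t, rfl⟩
    exact hγω t
  have hbdd : IsCompact (range fun t => (γ t).1) :=
    isCompact_range (continuous_fst.comp γ.continuous)
  let U : Set (ℝ × AddCircle L) := (range γ)ᶜ
  have hleft : ∀ x : ℝ × AddCircle L, x.1 ≤ a → x ∈ U := fun x hx h =>
    (hωsub (hKω h)).1.1.not_ge hx
  have hright : ∀ x : ℝ × AddCircle L, b ≤ x.1 → x ∈ U := fun x hx h =>
    (hωsub (hKω h)).1.2.not_ge hx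
  let x₀ : ℝ × AddCircle L := (a, 0)
  have hx₀ : x₀ ∈ connectedComponentIn U x₀ := mem_connectedComponentIn (hleft x₀ le_rfl)
  have hb : ∀ y : ℝ × AddCircle L, y.1 = b → y ∉ connectedComponentIn U x₀ := by
    intro y hy hmem
    let c : ℝ × AddCircle L → ℝ × AddCircle L := fun p => (max a (min b p.1), p.2)
    have hc : Continuous c := by fun_prop
    have hcx : c x₀ = x₀ := by simp [c, x₀, hab.le]
    have hcy : c y = y := by
      rw [Prod.ext_iff]
      simp [c, hy, hab.le]
    have hpre := isPreconnected_connectedComponentIn (F := U) (x := x₀) |>.image c hc.continuousOn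
    refine hsep x₀ y rfl hy (hpre.subset_connectedComponentIn ⟨x₀, hx₀, hcx⟩ ?_ ⟨y, hmem, hcy⟩)
    rintro _ ⟨z, hz, rfl⟩
    refine ⟨⟨⟨le_max_left _ _, max_le hab.le (min_le_left _ _)⟩, mem_univ _⟩, ?_⟩
    rcases le_total z.1 a with h | h
    · exact hleft _ (max_le le_rfl ((min_le_right _ _).trans h))
    rcases le_total b z.1 with h' | h'
    · exact hright _ (le_max_of_le_right (le_min le_rfl h'))
    have : c z = z := by
      rw [Prod.ext_iff]
      simp [c, h, h']
    rw [this]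
    exact connectedComponentIn_subset U x₀ hz
  have hleftΩ : ∀ p : ℝ × AddCircle L, a ≤ p.1 → p.1 ≤ sInf (range fun t => (γ t).1) → p ∉ ω →
      p ∈ connectedComponentIn U x₀ := by
    intro p hap hp hpω
    have hcirc : ({a} ×ˢ univ : Set (ℝ × AddCircle L)) ⊆ connectedComponentIn U x₀ :=
      (isPreconnected_singleton.prod isPreconnected_univ).subset_connectedComponentIn
        ⟨rfl, mem_univ _⟩ fun x hx => hleft x (le_of_eq hx.1)
    have hseg : IsPreconnected (Icc a p.1 ×ˢ {p.2} : Set (ℝ × AddCircle L)) :=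
      isPreconnected_Icc.prod isPreconnected_singleton
    refine hseg.subset_connectedComponentIn_of_mem (x := (a, p.2)) ?_ ⟨⟨le_rfl, hap⟩, rfl⟩
      (hcirc ⟨rfl, mem_univ _⟩) ⟨⟨hap, le_rfl⟩, rfl⟩
    rintro z ⟨hz1, hz2⟩ hzK
    obtain ⟨t, rfl⟩ := hzK
    have h := csInf_le hbdd.bddBelow (mem_range_self (f := fun t => (γ t).1) t)
    have : γ t = p := Prod.ext (le_antisymm hz1.2 (hp.trans h)) hz2
    exact hpω (this ▸ hγω t)
  have hrightΩ : ∀ p : ℝ × AddCircle L, p.1 ≤ b → sSup (range fun t => (γ t).1) ≤ p.1 → p ∉ ω →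
      p ∉ connectedComponentIn U x₀ := by
    intro p hpb hp hpω hmem
    have hseg : IsPreconnected (Icc p.1 b ×ˢ {p.2} : Set (ℝ × AddCircle L)) :=
      isPreconnected_Icc.prod isPreconnected_singleton
    refine hb (b, p.2) rfl (hseg.subset_connectedComponentIn_of_mem (x := p) ?_
      ⟨⟨le_rfl, hpb⟩, rfl⟩ hmem ⟨⟨hpb, le_rfl⟩, rfl⟩)
    rintro z ⟨hz1, hz2⟩ hzK
    obtain ⟨t, rfl⟩ := hzK
    have h := le_csSup hbdd.bddAbove (mem_range_self (f := fun t => (γ t).1) t)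
    have : γ t = p := Prod.ext (le_antisymm (h.trans hp) hz1.1) hz2
    exact hpω (this ▸ hγω t)
  obtain ⟨δ, hδ, hδω⟩ := hK.exists_thickening_subset_open hω hKω
  obtain ⟨χ, hsmooth, hχ⟩ := exists_contDiff_eq_indicator_connectedComponentIn hδ
    hK.isClosed.isOpen_compl x₀
  have hfar : ∀ p : ℝ × AddCircle L, p ∉ ω → ∀ q, dist q p < δ → q ∈ U := fun p hp q hq hqK =>
    hp (hδω (mem_thickening_iff.2 ⟨q, hqK, by rwa [dist_comm]⟩))
  have hval : ∀ p : ℝ × AddCircle L, p ∉ ω →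
      χ p = (connectedComponentIn U x₀).indicator (fun _ => 1) p := by
    intro p hp
    obtain ⟨p, rfl⟩ := surjective_cylinderProj L p
    exact (hχ p (hfar _ hp)).1
  refine ⟨χ, hsmooth, ?_, ?_, ?_⟩
  · rintro p ⟨⟨⟨h1, h2⟩, -⟩, hp⟩
    rw [hval p hp, indicator_of_notMem (hrightΩ p h2 h1 hp)]
  · rintro p ⟨⟨⟨h1, h2⟩, -⟩, hp⟩
    rw [hval p hp, indicator_of_mem (hleftΩ p h1 h2 hp)]
  · intro p hp
    by_contra hpω
    exact (hχ p (hfar (cylinderProj L p) hpω)).2 hp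
end
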